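/- The Chevalley–Eilenberg differential is a graded derivation of the convolution bracket: let K be a field of characteristic zero, g a Lie algebra over K and L a Lie algebra over K regarded as a trivial g-module. Then for all F ∈ C^{q_1} and H ∈ C^{q_2}, d_2 [F,H]_CE = [d_2 F, H]_CE + (−1)^{q_1} [F, d_2 H]_CE. Hence (⊕_q C^{q}, [·,·]_CE, d_2) is a differential graded Lie algebra. -/

import Mathlib

open scoped Classical

/-- Reindexing cast for maps on tuples. -/
def castFn {V L : Type*} {m n : ℕ} (h : m = n) (F : (Fin m → V) → L) :
    (Fin n → V) → L :=
  fun v => F fun i => v (Fin.cast h i)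

/-- The Chevalley–Eilenberg convolution bracket
`[F,H](v₁,…,v_{q₁+q₂}) = Σ_σ sgn(σ) ⁅F(v_{σ(1)},…,v_{σ(q₁)}), H(v_{σ(q₁+1)},…,v_{σ(q₁+q₂)})⁆`,
the sum over all `(q₁,q₂)`-shuffles `σ`. -/
noncomputable def ceBracket {V L : Type*} [LieRing L] {q₁ q₂ : ℕ}
    (F : (Fin q₁ → V) → L) (H : (Fin q₂ → V) → L) :
    (Fin (q₁ + q₂) → V) → L :=
  fun v => ∑ σ : Equiv.Perm (Fin (q₁ + q₂)),
    if (StrictMono fun i : Fin q₁ => σ (Fin.castAdd q₂ i)) ∧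
        (StrictMono fun j : Fin q₂ => σ (Fin.natAdd q₁ j)) then
      ((Equiv.Perm.sign σ : ℤˣ) : ℤ) •
        ⁅F fun i => v (σ (Fin.castAdd q₂ i)), H fun j => v (σ (Fin.natAdd q₁ j))⁆
    else 0

/-- The Chevalley–Eilenberg differential with trivial coefficients:
`(d₂F)(x_1,…,x_{q+1}) = Σ_{i<j} (−1)^{i+j} F([x_i,x_j], x_1,…,x̂_i,…,x̂_j,…,x_{q+1})`. -/
def ceDiff {g W : Type*} [LieRing g] [AddCommGroup W] {q : ℕ}
    (F : (Fin q → g) → W) : (Fin (q + 1) → g) → W :=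
  fun x =>
    ∑ p ∈ Finset.univ.filter (fun p : Fin (q + 1) × Fin (q + 1) => p.1 < p.2),
      ((-1 : ℤ) ^ ((p.1 : ℕ) + (p.2 : ℕ))) •
        F fun t =>
          if (t : ℕ) = 0 then ⁅x p.1, x p.2⁆
          else if (t : ℕ) - 1 < (p.1 : ℕ) then
            x ⟨(t : ℕ) - 1, by have := t.isLt; omega⟩
          else if (t : ℕ) < (p.2 : ℕ) then
            x ⟨(t : ℕ), by have := t.isLt; omega⟩
          else x ⟨(t : ℕ) + 1, by have := t.isLt; omega⟩

section Antisymmetrization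

variable {V W : Type*} [AddCommGroup W] {n : ℕ}

/-- A map of tuples is antisymmetric if permuting its arguments multiplies it by the sign. -/
def IsAntisymmetric (F : (Fin n → V) → W) : Prop :=
  ∀ (σ : Equiv.Perm (Fin n)) (v : Fin n → V),
    F (v ∘ σ) = ((Equiv.Perm.sign σ : ℤˣ) : ℤ) • F v

/-- The unnormalized signed sum of a map of tuples over all permutations of its arguments. -/
def antisymmetrize : ((Fin n → V) → W) →+ ((Fin n → V) → W) where
  toFun f v := ∑ σ : Equiv.Perm (Fin n), ((Equiv.Perm.sign σ : ℤˣ) : ℤ) • f (v ∘ σ)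
  map_zero' := by ext; simp
  map_add' f f' := by ext; simp [Finset.sum_add_distrib]

theorem antisymmetrize_apply (f : (Fin n → V) → W) (v : Fin n → V) :
    antisymmetrize f v =
      ∑ σ : Equiv.Perm (Fin n), ((Equiv.Perm.sign σ : ℤˣ) : ℤ) • f (v ∘ σ) := rfl

theorem antisymmetrize_eq_sum (f : (Fin n → V) → W) :
    antisymmetrize f =
      ∑ σ : Equiv.Perm (Fin n), ((Equiv.Perm.sign σ : ℤˣ) : ℤ) • fun v => f (v ∘ σ) := by
  ext v
  simp [antisymmetrize_apply, Finset.sum_apply]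

theorem sign_mul_sign_self (σ : Equiv.Perm (Fin n)) :
    ((Equiv.Perm.sign σ : ℤˣ) : ℤ) * ((Equiv.Perm.sign σ : ℤˣ) : ℤ) = 1 := by
  rw [← Units.val_mul, Int.units_mul_self, Units.val_one]

theorem antisymmetrize_comp_perm (f : (Fin n → V) → W) (π : Equiv.Perm (Fin n)) :
    antisymmetrize (fun v => f (v ∘ π)) =
      ((Equiv.Perm.sign π : ℤˣ) : ℤ) • antisymmetrize f := by
  ext v
  simp only [antisymmetrize_apply, Pi.smul_apply, Finset.smul_sum, smul_smul]
  refine Fintype.sum_equiv (Equiv.mulRight π) _ _ fun σ => ?_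
  simp only [Equiv.coe_mulRight, Equiv.Perm.sign_mul, Units.val_mul]
  rw [mul_comm, mul_assoc, sign_mul_sign_self, mul_one]
  rfl

theorem isAntisymmetric_antisymmetrize (f : (Fin n → V) → W) :
    IsAntisymmetric (antisymmetrize f) := by
  intro π v
  simp only [antisymmetrize_apply, Finset.smul_sum, smul_smul]
  refine Fintype.sum_equiv (Equiv.mulLeft π) _ _ fun σ => ?_
  simp only [Equiv.coe_mulLeft, Equiv.Perm.sign_mul, Units.val_mul]
  rw [← mul_assoc, sign_mul_sign_self, one_mul]
  rfl

theorem IsAntisymmetric.of_zsmul [IsAddTorsionFree W] {F : (Fin n → V) → W} {c : ℤ}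
    (hc : c ≠ 0) (h : IsAntisymmetric (c • F)) : IsAntisymmetric F := by
  intro σ v
  apply zsmul_right_injective hc
  have := h σ v
  simp only [Pi.smul_apply] at this
  simp only [this, smul_comm c]

theorem IsAntisymmetric.antisymmetrize_eq {F : (Fin n → V) → W} (hF : IsAntisymmetric F) :
    antisymmetrize F = (n.factorial : ℤ) • F := by
  ext v
  simp only [antisymmetrize_apply, hF _ v, smul_smul, sign_mul_sign_self, one_smul]
  simp [Fintype.card_perm]

theorem antisymmetrize_castFn {m : ℕ} (h : m = n) (f : (Fin m → V) → W) :
    antisymmetrize (castFn h f) = castFn h (antisymmetrize f) := by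
  subst h
  rfl

/-- Expansion of the antisymmetrization along the first argument. -/
theorem antisymmetrize_succ (f : (Fin (n + 1) → V) → W) (v : Fin (n + 1) → V) :
    antisymmetrize f v = ∑ i : Fin (n + 1), (-1 : ℤ) ^ (i : ℕ) •
      antisymmetrize (fun u : Fin n → V => f (Fin.cons (v i) u)) (v ∘ i.succAbove) := by
  simp only [antisymmetrize_apply, Finset.smul_sum, smul_smul]
  rw [← Fintype.sum_prod_type']
  symm
  let e : Fin (n + 1) × Equiv.Perm (Fin n) → Equiv.Perm (Fin (n + 1)) :=
    fun p => p.1.cycleRange⁻¹ * Equiv.Perm.decomposeFin.symm (0, p.2)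
  have e_zero (p) : e p 0 = p.1 := by
    simp [e, Equiv.Perm.inv_def]
  have e_succ (p) (t : Fin n) : e p t.succ = p.1.succAbove (p.2 t) := by
    simp [e, Equiv.Perm.inv_def]
  refine Fintype.sum_bijective e ?_ _ _ ?_
  · rw [Fintype.bijective_iff_injective_and_card]
    refine ⟨fun p p' h => ?_, by simp [Fintype.card_perm, Nat.factorial_succ]⟩
    have h1 : p.1 = p'.1 := by rw [← e_zero p, h, e_zero]
    refine Prod.ext h1 (Equiv.ext fun t => ?_)
    apply Fin.succAbove_right_injective (p := p.1)
    rw [← e_succ, h, e_succ, h1]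
  · rintro ⟨i, τ⟩
    have hs : Equiv.Perm.sign (e (i, τ)) = (-1) ^ (i : ℕ) * Equiv.Perm.sign τ := by
      simp [e, Fin.sign_cycleRange]
    rw [hs]
    congr 1
    refine congrArg f (funext fun t => ?_)
    refine Fin.cases ?_ (fun t => ?_) t
    · simp [e_zero]
    · simp [e_succ]

end Antisymmetrization

section LiePair

variable {V L : Type*} [LieRing L] {q₁ q₂ : ℕ}

/-- The product of two maps of tuples: evaluate them on the first `q₁` and on the last `q₂`
arguments and take the bracket. -/
def liePair (F : (Fin q₁ → V) → L) (H : (Fin q₂ → V) → L) : (Fin (q₁ + q₂) → V) → L :=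
  fun v => ⁅F (v ∘ Fin.castAdd q₂), H (v ∘ Fin.natAdd q₁)⁆

/-- The block permutation of `Fin (q₁ + q₂)` with blocks `α` and `β`. -/
def blockPerm (α : Equiv.Perm (Fin q₁)) (β : Equiv.Perm (Fin q₂)) :
    Equiv.Perm (Fin (q₁ + q₂)) :=
  finSumFinEquiv.permCongr (Equiv.Perm.sumCongr α β)

@[simp]
theorem blockPerm_castAdd (α : Equiv.Perm (Fin q₁)) (β : Equiv.Perm (Fin q₂)) (i : Fin q₁) :
    blockPerm α β (Fin.castAdd q₂ i) = Fin.castAdd q₂ (α i) := by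
  simp [blockPerm, Equiv.permCongr_apply]

@[simp]
theorem blockPerm_natAdd (α : Equiv.Perm (Fin q₁)) (β : Equiv.Perm (Fin q₂)) (j : Fin q₂) :
    blockPerm α β (Fin.natAdd q₁ j) = Fin.natAdd q₁ (β j) := by
  simp [blockPerm, Equiv.permCongr_apply]

@[simp]
theorem sign_blockPerm (α : Equiv.Perm (Fin q₁)) (β : Equiv.Perm (Fin q₂)) :
    Equiv.Perm.sign (blockPerm α β) = Equiv.Perm.sign α * Equiv.Perm.sign β := by
  simp [blockPerm, Equiv.Perm.sign_permCongr, Equiv.Perm.sign_sumCongr]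

theorem comp_blockPerm_castAdd (v : Fin (q₁ + q₂) → V) (α : Equiv.Perm (Fin q₁))
    (β : Equiv.Perm (Fin q₂)) :
    (v ∘ blockPerm α β) ∘ Fin.castAdd q₂ = (v ∘ Fin.castAdd q₂) ∘ α := by
  ext i
  simp

theorem comp_blockPerm_natAdd (v : Fin (q₁ + q₂) → V) (α : Equiv.Perm (Fin q₁))
    (β : Equiv.Perm (Fin q₂)) :
    (v ∘ blockPerm α β) ∘ Fin.natAdd q₁ = (v ∘ Fin.natAdd q₁) ∘ β := by
  ext i
  simp

theorem liePair_zsmul_left (c : ℤ) (F : (Fin q₁ → V) → L) (H : (Fin q₂ → V) → L) :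
    liePair (c • F) H = c • liePair F H := by
  ext v
  simp [liePair]

theorem liePair_zsmul_right (c : ℤ) (F : (Fin q₁ → V) → L) (H : (Fin q₂ → V) → L) :
    liePair F (c • H) = c • liePair F H := by
  ext v
  simp [liePair]

theorem antisymmetrize_liePair_antisymmetrize_left (F : (Fin q₁ → V) → L)
    (H : (Fin q₂ → V) → L) :
    antisymmetrize (liePair (antisymmetrize F) H) =
      (q₁.factorial : ℤ) • antisymmetrize (liePair F H) := by
  have h : liePair (antisymmetrize F) H =
      ∑ σ : Equiv.Perm (Fin q₁), ((Equiv.Perm.sign σ : ℤˣ) : ℤ) •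
        fun v => liePair F H (v ∘ blockPerm σ 1) := by
    ext v
    simp [liePair, antisymmetrize_apply, comp_blockPerm_castAdd, comp_blockPerm_natAdd,
      Finset.sum_apply, sum_lie]
  rw [h, map_sum]
  simp only [map_zsmul, antisymmetrize_comp_perm, smul_smul, sign_blockPerm, Equiv.Perm.sign_one,
    mul_one, sign_mul_sign_self, one_smul]
  simp [Fintype.card_perm]

theorem antisymmetrize_liePair_antisymmetrize_right (F : (Fin q₁ → V) → L)
    (H : (Fin q₂ → V) → L) :
    antisymmetrize (liePair F (antisymmetrize H)) =
      (q₂.factorial : ℤ) • antisymmetrize (liePair F H) := by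
  have h : liePair F (antisymmetrize H) =
      ∑ σ : Equiv.Perm (Fin q₂), ((Equiv.Perm.sign σ : ℤˣ) : ℤ) •
        fun v => liePair F H (v ∘ blockPerm 1 σ) := by
    ext v
    simp [liePair, antisymmetrize_apply, comp_blockPerm_castAdd, comp_blockPerm_natAdd,
      Finset.sum_apply, lie_sum]
  rw [h, map_sum]
  simp only [map_zsmul, antisymmetrize_comp_perm, smul_smul, sign_blockPerm, Equiv.Perm.sign_one,
    one_mul, sign_mul_sign_self, one_smul]
  simp [Fintype.card_perm]

/-- A permutation is a shuffle if it is increasing on both blocks. -/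
def IsShuffle (q₁ q₂ : ℕ) (σ : Equiv.Perm (Fin (q₁ + q₂))) : Prop :=
  (StrictMono fun i : Fin q₁ => σ (Fin.castAdd q₂ i)) ∧
    (StrictMono fun j : Fin q₂ => σ (Fin.natAdd q₁ j))

theorem eq_of_strictMono_comp_perm_eq {ι : Type*} [LinearOrder ι] {m : ℕ} {f f' : Fin m → ι}
    (hf : StrictMono f) (hf' : StrictMono f') {α α' : Equiv.Perm (Fin m)}
    (h : ∀ i, f (α i) = f' (α' i)) : f = f' ∧ α = α' := by
  have hff : f = f' := by
    rw [← hf.range_inj hf', ← α.surjective.range_comp f, ← α'.surjective.range_comp f']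
    exact congrArg Set.range (funext h)
  exact ⟨hff, Equiv.ext fun i => hf.injective ((h i).trans (by rw [hff]))⟩

/-- Every permutation is uniquely a shuffle composed with a block permutation. -/
theorem bijective_shuffle_mul_blockPerm :
    Function.Bijective
      fun p : {σ // IsShuffle q₁ q₂ σ} × Equiv.Perm (Fin q₁) × Equiv.Perm (Fin q₂) =>
        p.1.1 * blockPerm p.2.1 p.2.2 := by
  constructor
  · rintro ⟨⟨s, hs⟩, α, β⟩ ⟨⟨s', hs'⟩, α', β'⟩ h
    simp only at h
    obtain ⟨h1, rfl⟩ := eq_of_strictMono_comp_perm_eq hs.1 hs'.1 (α := α) (α' := α')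
      fun i => by simpa using Equiv.congr_fun h (Fin.castAdd q₂ i)
    obtain ⟨h2, rfl⟩ := eq_of_strictMono_comp_perm_eq hs.2 hs'.2 (α := β) (α' := β')
      fun i => by simpa using Equiv.congr_fun h (Fin.natAdd q₁ i)
    have : s = s' := mul_right_cancel h
    subst this
    rfl
  · intro ρ
    have key (m : ℕ) (f : Fin m → Fin (q₁ + q₂)) (hf : Function.Injective f) :
        StrictMono (ρ ∘ f ∘ Tuple.sort (ρ ∘ f)) :=
      (Tuple.monotone_sort (ρ ∘ f)).strictMono_of_injective
        ((ρ.injective.comp hf).comp (Equiv.injective _))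
    let α := Tuple.sort (ρ ∘ Fin.castAdd (m := q₂) (n := q₁))
    let β := Tuple.sort (ρ ∘ Fin.natAdd (m := q₂) q₁)
    refine ⟨(⟨ρ * blockPerm α β, ?_, ?_⟩, α⁻¹, β⁻¹), ?_⟩
    · simpa [Function.comp_def, α] using key _ _ (Fin.castAdd_injective q₁ q₂)
    · simpa [Function.comp_def, β] using key _ _ (Fin.natAdd_injective q₂ q₁)
    · ext x
      refine Fin.addCases (fun i => ?_) (fun i => ?_) x <;> simp

theorem antisymmetrize_liePair {F : (Fin q₁ → V) → L} {H : (Fin q₂ → V) → L}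
    (hF : IsAntisymmetric F) (hH : IsAntisymmetric H) :
    antisymmetrize (liePair F H) =
      ((q₁.factorial * q₂.factorial : ℕ) : ℤ) • ceBracket F H := by
  ext v
  rw [antisymmetrize_apply, ← bijective_shuffle_mul_blockPerm.sum_comp, Pi.smul_apply, ceBracket,
    ← Finset.sum_filter, Fintype.sum_prod_type, Finset.smul_sum]
  have term (s : Equiv.Perm (Fin (q₁ + q₂)))
      (p : Equiv.Perm (Fin q₁) × Equiv.Perm (Fin q₂)) :
      ((Equiv.Perm.sign (s * blockPerm p.1 p.2) : ℤˣ) : ℤ) •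
        liePair F H (v ∘ ⇑(s * blockPerm p.1 p.2)) =
      ((Equiv.Perm.sign s : ℤˣ) : ℤ) • liePair F H (v ∘ s) := by
    rw [Equiv.Perm.coe_mul, ← Function.comp_assoc, liePair, comp_blockPerm_castAdd,
      comp_blockPerm_natAdd, hF, hH, smul_lie, lie_smul, smul_smul, smul_smul, Equiv.Perm.sign_mul,
      sign_blockPerm, liePair]
    congr 1
    push_cast
    linear_combination (((Equiv.Perm.sign s : ℤˣ) : ℤ) * ((Equiv.Perm.sign p.2 : ℤˣ) : ℤ) *
      ((Equiv.Perm.sign p.2 : ℤˣ) : ℤ)) * sign_mul_sign_self p.1 +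
      ((Equiv.Perm.sign s : ℤˣ) : ℤ) * sign_mul_sign_self p.2
  simp only [term, Finset.sum_const, Finset.card_univ, Fintype.card_prod, Fintype.card_perm,
    Fintype.card_fin]
  rw [Finset.sum_subtype (p := IsShuffle q₁ q₂) _ (by simp [IsShuffle])]
  simp only [natCast_zsmul]
  rfl

end LiePair

section BracketInsert

variable {g W L : Type*} [LieRing g] [AddCommGroup W] [LieRing L] {n : ℕ}

/-- Replace the `k`-th and `(k+1)`-st entries of a tuple by their bracket. -/
def bracketInsert (k : Fin n) (z : Fin (n + 1) → g) : Fin n → g :=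
  fun t => if t < k then z t.castSucc else if t = k then ⁅z k.castSucc, z k.succ⁆ else z t.succ

theorem exists_eq_comp_val {V : Type*} [Zero V] (z : Fin n → V) :
    ∃ y : ℕ → V, z = fun i : Fin n => y i :=
  ⟨fun i => if h : i < n then z ⟨i, h⟩ else 0, by ext i; simp⟩

/-- Permuting the entries of `bracketInsert k z` moves the bracket and permutes `z`. -/
theorem exists_bracketInsert_comp_perm (σ : Equiv.Perm (Fin n)) (k : Fin n) :
    ∃ π : Equiv.Perm (Fin (n + 1)),
      (∀ z : Fin (n + 1) → g, bracketInsert k z ∘ σ = bracketInsert (σ.symm k) (z ∘ π)) ∧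
      ((Equiv.Perm.sign π : ℤˣ) : ℤ) * (-1) ^ (k : ℕ) =
        ((Equiv.Perm.sign σ : ℤˣ) : ℤ) * (-1) ^ (σ.symm k : ℕ) := by
  cases n with
  | zero => exact k.elim0
  | succ m =>
  have hσ : σ ∈ Submonoid.closure
      (Set.range fun i : Fin m => Equiv.swap i.castSucc i.succ) := by
    rw [Equiv.Perm.mclosure_swap_castSucc_succ]
    trivial
  induction hσ using Submonoid.closure_induction generalizing k with
  | one => exact ⟨1, fun z => rfl, by
    simp [show Equiv.symm (1 : Equiv.Perm (Fin (m + 1))) = 1 from rfl]⟩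
  | mul σ τ _ _ hσ hτ =>
    obtain ⟨π, h1, h2⟩ := hσ k
    obtain ⟨ρ, h3, h4⟩ := hτ (σ.symm k)
    refine ⟨π * ρ, fun z => ?_, ?_⟩
    · rw [Equiv.Perm.coe_mul, ← Function.comp_assoc, h1, h3]
      rfl
    · have h5 : (σ * τ).symm k = τ.symm (σ.symm k) := rfl
      rw [h5, Equiv.Perm.sign_mul, Equiv.Perm.sign_mul, Units.val_mul, Units.val_mul]
      linear_combination ((Equiv.Perm.sign ρ : ℤˣ) : ℤ) * h2 +
        ((Equiv.Perm.sign σ : ℤˣ) : ℤ) * h4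
  | mem σ hσ =>
    obtain ⟨i, rfl⟩ := hσ
    have hne : i.castSucc ≠ i.succ := by simp [Fin.ext_iff]
    have hn1 : i.castSucc.castSucc ≠ i.castSucc.succ := by simp [Fin.ext_iff]
    have hn2 : i.castSucc.succ ≠ i.succ.succ := by simp [Fin.ext_iff]
    simp only [Equiv.symm_swap, Equiv.Perm.sign_swap hne]
    have hval {r : ℕ} (a b t : Fin r) :
        ((Equiv.swap a b t : Fin r) : ℕ) = if (t : ℕ) = a then (b : ℕ)
          else if (t : ℕ) = b then (a : ℕ) else t := by
      rw [Equiv.swap_apply_def]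
      split_ifs <;> simp_all [Fin.ext_iff]
    rcases lt_trichotomy k i.castSucc with hk | rfl | hk
    · refine ⟨Equiv.swap i.castSucc.succ i.succ.succ, fun z => ?_, ?_⟩
      · obtain ⟨y, rfl⟩ := exists_eq_comp_val z
        ext t
        simp only [bracketInsert, Function.comp_apply, Fin.lt_def, Fin.ext_iff, hval,
          Fin.val_succ, Fin.val_castSucc] at *
        grind
      · rw [Equiv.Perm.sign_swap hn2, Equiv.swap_apply_of_ne_of_ne hk.ne
          (hk.trans (Fin.castSucc_lt_succ)).ne]
    · refine ⟨Equiv.swap i.castSucc.succ i.succ.succ * Equiv.swap i.castSucc.castSucc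
        i.castSucc.succ, fun z => ?_, ?_⟩
      · obtain ⟨y, rfl⟩ := exists_eq_comp_val z
        ext t
        simp only [bracketInsert, Function.comp_apply, Fin.lt_def, Fin.ext_iff, hval,
          Fin.val_succ, Fin.val_castSucc, Equiv.Perm.mul_apply] at *
        grind
      · simp [Equiv.Perm.sign_swap hn1, Equiv.Perm.sign_swap hn2, pow_succ]
    · have hk' : i.succ ≤ k := Fin.castSucc_lt_iff_succ_le.1 hk
      rcases hk'.eq_or_lt with rfl | hk'
      · refine ⟨Equiv.swap i.castSucc.castSucc i.castSucc.succ *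
          Equiv.swap i.castSucc.succ i.succ.succ, fun z => ?_, ?_⟩
        · obtain ⟨y, rfl⟩ := exists_eq_comp_val z
          ext t
          simp only [bracketInsert, Function.comp_apply, Fin.lt_def, Fin.ext_iff, hval,
            Fin.val_succ, Fin.val_castSucc, Equiv.Perm.mul_apply] at *
          grind
        · simp [Equiv.Perm.sign_swap hn1, Equiv.Perm.sign_swap hn2, pow_succ]
      · refine ⟨Equiv.swap i.castSucc.castSucc i.castSucc.succ, fun z => ?_, ?_⟩
        · obtain ⟨y, rfl⟩ := exists_eq_comp_val z
          ext t
          simp only [bracketInsert, Function.comp_apply, Fin.lt_def, Fin.ext_iff, hval,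
            Fin.val_succ, Fin.val_castSucc] at *
          grind
        · rw [Equiv.Perm.sign_swap hn1, Equiv.swap_apply_of_ne_of_ne hk.ne' hk'.ne']

/-- The signed sum over all insertions of a bracket: the derivation of the (nonantisymmetric)
tensor product dual to the bracket. -/
def bracketDerivation : ((Fin n → g) → W) →+ ((Fin (n + 1) → g) → W) where
  toFun f z := ∑ k : Fin n, (-1 : ℤ) ^ (k : ℕ) • f (bracketInsert k z)
  map_zero' := by ext; simp
  map_add' f f' := by ext; simp [Finset.sum_add_distrib]

theorem bracketDerivation_eq_sum (f : (Fin n → g) → W) :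
    bracketDerivation f =
      ∑ k : Fin n, (-1 : ℤ) ^ (k : ℕ) • fun z => f (bracketInsert k z) := by
  ext z
  simp [bracketDerivation, Finset.sum_apply]

theorem antisymmetrize_bracketDerivation_comp_perm (f : (Fin n → g) → W)
    (σ : Equiv.Perm (Fin n)) :
    antisymmetrize (bracketDerivation fun v => f (v ∘ σ)) =
      ((Equiv.Perm.sign σ : ℤˣ) : ℤ) • antisymmetrize (bracketDerivation f) := by
  simp only [bracketDerivation_eq_sum, map_sum, map_zsmul, Finset.smul_sum, smul_smul]
  refine Fintype.sum_equiv σ.symm _ _ fun k => ?_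
  obtain ⟨π, h1, h2⟩ := exists_bracketInsert_comp_perm (g := g) σ k
  simp only [h1]
  rw [antisymmetrize_comp_perm (fun z => f (bracketInsert (σ.symm k) z)) π, smul_smul, ← h2,
    mul_comm]

theorem antisymmetrize_bracketDerivation_antisymmetrize (f : (Fin n → g) → W) :
    antisymmetrize (bracketDerivation (antisymmetrize f)) =
      (n.factorial : ℤ) • antisymmetrize (bracketDerivation f) := by
  rw [antisymmetrize_eq_sum f]
  simp only [map_sum, map_zsmul, antisymmetrize_bracketDerivation_comp_perm, smul_smul,
    sign_mul_sign_self, one_smul]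
  simp [Fintype.card_perm]

theorem IsAntisymmetric.antisymmetrize_bracketInsert {F : (Fin (n + 1) → g) → W}
    (hF : IsAntisymmetric F) (k : Fin (n + 1)) :
    (-1 : ℤ) ^ (k : ℕ) • antisymmetrize (fun z => F (bracketInsert k z)) =
      antisymmetrize (fun z => F (bracketInsert 0 z)) := by
  obtain ⟨π, h1, h2⟩ := exists_bracketInsert_comp_perm (g := g) (Equiv.swap 0 k) k
  simp only [Equiv.symm_swap, Equiv.swap_apply_right] at h1 h2
  have h3 : (fun z => F (bracketInsert k z)) = ((Equiv.Perm.sign (Equiv.swap 0 k) : ℤˣ) : ℤ) •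
      fun z => F (bracketInsert 0 (z ∘ π)) := by
    ext z
    rw [Pi.smul_apply, ← h1, hF, smul_smul, sign_mul_sign_self, one_smul]
  rw [h3, map_zsmul, antisymmetrize_comp_perm (fun z => F (bracketInsert 0 z)) π, smul_smul,
    smul_smul, mul_assoc]
  have h4 := sign_mul_sign_self (Equiv.swap 0 k)
  rw [show (-1 : ℤ) ^ (k : ℕ) * (((Equiv.Perm.sign (Equiv.swap 0 k) : ℤˣ) : ℤ) *
      ((Equiv.Perm.sign π : ℤˣ) : ℤ)) = 1 by
    rw [Fin.val_zero, pow_zero] at h2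
    linear_combination ((Equiv.Perm.sign (Equiv.swap 0 k) : ℤˣ) : ℤ) * h2 + h4, one_smul]

theorem bracketInsert_zero_cons_cons (a b : g) (u : Fin n → g) :
    bracketInsert 0 (Fin.cons a (Fin.cons b u) : Fin (n + 2) → g) = Fin.cons ⁅a, b⁆ u := by
  ext t
  refine Fin.cases ?_ (fun t => ?_) t
  · simp [bracketInsert]
  · simp [bracketInsert]

theorem IsAntisymmetric.cons {V : Type*} {F : (Fin (n + 1) → V) → W} (hF : IsAntisymmetric F)
    (a : V) : IsAntisymmetric fun u : Fin n → V => F (Fin.cons a u) := by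
  intro σ u
  have h := hF (Equiv.Perm.decomposeFin.symm (0, σ)) (Fin.cons a u)
  simp only [Equiv.Perm.decomposeFin.symm_sign, if_true, one_mul] at h
  simp only [← h]
  congr 1
  ext t
  refine Fin.cases ?_ (fun t => ?_) t <;> simp

/-- The argument of `F` in the term of `ceDiff F` indexed by a pair. -/
def ceDiffArg {q : ℕ} (x : Fin (q + 1) → g) (a b : Fin (q + 1)) : Fin q → g := fun t =>
  if (t : ℕ) = 0 then ⁅x a, x b⁆
  else if (t : ℕ) - 1 < (a : ℕ) then
    x ⟨(t : ℕ) - 1, by have := t.isLt; omega⟩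
  else if (t : ℕ) < (b : ℕ) then
    x ⟨(t : ℕ), by have := t.isLt; omega⟩
  else x ⟨(t : ℕ) + 1, by have := t.isLt; omega⟩

theorem ceDiffArg_of_le (x : Fin (n + 2) → g) (i : Fin (n + 2)) (j : Fin (n + 1))
    (h : i ≤ j.castSucc) :
    ceDiffArg x i (i.succAbove j) =
      Fin.cons ⁅x i, x (i.succAbove j)⁆ ((x ∘ i.succAbove) ∘ j.succAbove) := by
  ext t
  refine Fin.cases ?_ (fun t => ?_) t
  · simp [ceDiffArg]
  · obtain ⟨y, rfl⟩ := exists_eq_comp_val x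
    simp only [ceDiffArg, Fin.cons_succ, Function.comp_apply, Fin.succAbove, Fin.lt_def,
      Fin.le_def, Fin.val_succ, Fin.val_castSucc, apply_ite Fin.val] at *
    grind

theorem ceDiffArg_of_lt (x : Fin (n + 2) → g) (i : Fin (n + 2)) (j : Fin (n + 1))
    (h : j.castSucc < i) :
    ceDiffArg x (i.succAbove j) i =
      Fin.cons ⁅x (i.succAbove j), x i⁆ ((x ∘ i.succAbove) ∘ j.succAbove) := by
  ext t
  refine Fin.cases ?_ (fun t => ?_) t
  · simp [ceDiffArg]
  · obtain ⟨y, rfl⟩ := exists_eq_comp_val x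
    simp only [ceDiffArg, Fin.cons_succ, Function.comp_apply, Fin.succAbove, Fin.lt_def,
      Fin.val_succ, Fin.val_castSucc, apply_ite Fin.val] at *
    grind

/-- A map of tuples is odd if negating any one argument negates the value. -/
def IsOddInEach {V : Type*} [Neg V] (F : (Fin n → V) → W) : Prop :=
  ∀ (i : Fin n) (v : Fin n → V), F (Function.update v i (-v i)) = -F v

theorem IsOddInEach.cons_neg {V : Type*} [Neg V] {F : (Fin (n + 1) → V) → W}
    (hF : IsOddInEach F) (a : V) (u : Fin n → V) :
    F (Fin.cons (-a) u) = -F (Fin.cons a u) := by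
  rw [← hF 0, Fin.update_cons_zero, Fin.cons_zero]

theorem two_zsmul_ceDiff {F : (Fin (n + 1) → g) → W} (hF : IsOddInEach F)
    (x : Fin (n + 2) → g) :
    (2 : ℤ) • ceDiff F x = -∑ i : Fin (n + 2), ∑ j : Fin (n + 1), (-1 : ℤ) ^ ((i : ℕ) + (j : ℕ)) •
      F (Fin.cons ⁅x i, x (i.succAbove j)⁆ ((x ∘ i.succAbove) ∘ j.succAbove)) := by
  let T (a b : Fin (n + 2)) : W :=
    if a < b then (-1 : ℤ) ^ ((a : ℕ) + (b : ℕ)) • F (ceDiffArg x a b) else 0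
  have h1 : ceDiff F x = ∑ a, ∑ b, T a b := by
    rw [← Fintype.sum_prod_type', ← Finset.sum_filter]
    rfl
  have h2 : ∑ a, ∑ b, T a b = ∑ a, ∑ b, T b a := Finset.sum_comm
  rw [two_zsmul]
  nth_rewrite 2 [h1]
  rw [h1, h2, ← h2, ← Finset.sum_neg_distrib]
  nth_rewrite 2 [h2]
  rw [← Finset.sum_add_distrib]
  refine Finset.sum_congr rfl fun i _ => ?_
  rw [← Finset.sum_add_distrib, Fin.sum_univ_succAbove _ i, ← Finset.sum_neg_distrib]
  simp only [T, lt_self_iff_false, if_false, zero_add]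
  refine Finset.sum_congr rfl fun j _ => ?_
  rcases lt_or_ge j.castSucc i with h | h
  · have h3 : i.succAbove j < i := by rwa [Fin.succAbove_of_castSucc_lt _ _ h]
    rw [if_neg h3.not_gt, if_pos h3, zero_add, ceDiffArg_of_lt x i j h, ← lie_skew,
      hF.cons_neg, Fin.succAbove_of_castSucc_lt _ _ h, smul_neg, Fin.val_castSucc, add_comm]
  · have h3 : i < i.succAbove j := by
      rw [Fin.succAbove_of_le_castSucc _ _ h]
      exact Fin.lt_def.2 (by simpa using Nat.lt_succ_of_le (Fin.le_def.1 h))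
    rw [if_neg h3.not_gt, if_pos h3, add_zero, ceDiffArg_of_le x i j h,
      Fin.succAbove_of_le_castSucc _ _ h, Fin.val_succ, ← add_assoc, pow_succ, mul_neg_one,
      neg_smul]

theorem antisymmetrize_bracketDerivation {F : (Fin n → g) → W} (hF : IsAntisymmetric F)
    (hF' : IsOddInEach F) :
    antisymmetrize (bracketDerivation F) = (-(2 * n.factorial) : ℤ) • ceDiff F := by
  cases n with
  | zero =>
    have h1 : bracketDerivation F = 0 := by
      ext z
      simp [bracketDerivation]
    have h2 : ceDiff F = 0 := by
      ext z
      exact Finset.sum_eq_zero fun p hp => by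
        have := (Finset.mem_filter.1 hp).2
        omega
    rw [h1, h2, map_zero, smul_zero]
  | succ m =>
    have h1 : antisymmetrize (fun z => F (bracketInsert 0 z)) =
        (-(2 * m.factorial) : ℤ) • ceDiff F := by
      ext x
      rw [Pi.smul_apply, neg_smul, mul_comm, mul_smul, two_zsmul_ceDiff hF', smul_neg, neg_neg]
      simp only [antisymmetrize_succ, bracketInsert_zero_cons_cons, Finset.smul_sum,
        (hF.cons _).antisymmetrize_eq, Pi.smul_apply, smul_smul, Function.comp_apply]
      refine Finset.sum_congr rfl fun i _ => Finset.sum_congr rfl fun j _ => ?_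
      congr 1
      ring
    rw [bracketDerivation_eq_sum, map_sum]
    simp only [map_zsmul, hF.antisymmetrize_bracketInsert, h1]
    rw [Finset.sum_const, Finset.card_univ, Fintype.card_fin, ← natCast_zsmul, smul_smul]
    congr 1
    push_cast [Nat.factorial_succ]
    ring

theorem bracketDerivation_liePair {q₁ q₂ : ℕ} (h₁ : q₁ + 1 + q₂ = q₁ + q₂ + 1)
    (h₂ : q₁ + (q₂ + 1) = q₁ + q₂ + 1) (F : (Fin q₁ → g) → L) (H : (Fin q₂ → g) → L) :
    bracketDerivation (liePair F H) =
      castFn h₁ (liePair (bracketDerivation F) H) +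
        ((-1 : ℤ) ^ q₁) • castFn h₂ (liePair F (bracketDerivation H)) := by
  ext z
  simp only [bracketDerivation, AddMonoidHom.coe_mk, ZeroHom.coe_mk, Fin.sum_univ_add, castFn,
    liePair, Pi.add_apply, Pi.smul_apply, Fin.val_castAdd, Fin.val_natAdd]
  congr 1
  · simp only [sum_lie, smul_lie]
    refine Finset.sum_congr rfl fun k _ => ?_
    congr 3
    · obtain ⟨y, rfl⟩ := exists_eq_comp_val z
      ext t
      simp only [bracketInsert, Function.comp_apply, Fin.lt_def, Fin.ext_iff, Fin.val_castAdd,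
        Fin.val_succ, Fin.val_castSucc, Fin.val_cast]
    · obtain ⟨y, rfl⟩ := exists_eq_comp_val z
      ext t
      simp only [bracketInsert, Function.comp_apply, Fin.lt_def, Fin.ext_iff, Fin.val_castAdd,
        Fin.val_natAdd, Fin.val_succ, Fin.val_castSucc, Fin.val_cast]
      grind
  · simp only [lie_sum, lie_smul, Finset.smul_sum, smul_smul, ← pow_add]
    refine Finset.sum_congr rfl fun k _ => ?_
    congr 3
    · obtain ⟨y, rfl⟩ := exists_eq_comp_val z
      ext t
      simp only [bracketInsert, Function.comp_apply, Fin.lt_def, Fin.ext_iff, Fin.val_castAdd,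
        Fin.val_natAdd, Fin.val_succ, Fin.val_castSucc, Fin.val_cast]
      grind
    · obtain ⟨y, rfl⟩ := exists_eq_comp_val z
      ext t
      simp only [bracketInsert, Function.comp_apply, Fin.lt_def, Fin.ext_iff, Fin.val_natAdd,
        Fin.val_succ, Fin.val_castSucc, Fin.val_cast]
      grind

theorem IsOddInEach.ceBracket {V : Type*} [Neg V] {q₁ q₂ : ℕ} {F : (Fin q₁ → V) → L}
    {H : (Fin q₂ → V) → L} (hF : IsOddInEach F) (hH : IsOddInEach H) :
    IsOddInEach (ceBracket F H) := by
  have hpair : IsOddInEach (liePair F H) := by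
    intro i v
    refine Fin.addCases (fun i => ?_) (fun i => ?_) i
    · have h1 : Function.update v (Fin.castAdd q₂ i) (-v (Fin.castAdd q₂ i)) ∘ Fin.castAdd q₂ =
          Function.update (v ∘ Fin.castAdd q₂) i (-(v ∘ Fin.castAdd q₂) i) :=
        Function.update_comp_eq_of_injective _ (Fin.castAdd_injective _ _) _ _
      have h2 : Function.update v (Fin.castAdd q₂ i) (-v (Fin.castAdd q₂ i)) ∘ Fin.natAdd q₁ =
          v ∘ Fin.natAdd q₁ :=
        Function.update_comp_eq_of_forall_ne _ _ fun j => by simp [Fin.ext_iff]; omega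
      rw [liePair, h1, h2, hF, neg_lie, liePair]
    · have h1 : Function.update v (Fin.natAdd q₁ i) (-v (Fin.natAdd q₁ i)) ∘ Fin.natAdd q₁ =
          Function.update (v ∘ Fin.natAdd q₁) i (-(v ∘ Fin.natAdd q₁) i) :=
        Function.update_comp_eq_of_injective _ (Fin.natAdd_injective _ _) _ _
      have h2 : Function.update v (Fin.natAdd q₁ i) (-v (Fin.natAdd q₁ i)) ∘ Fin.castAdd q₂ =
          v ∘ Fin.castAdd q₂ :=
        Function.update_comp_eq_of_forall_ne _ _ fun j => by simp [Fin.ext_iff]; omega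
      rw [liePair, h1, h2, hH, lie_neg, liePair]
  intro i v
  simp only [_root_.ceBracket, ← Finset.sum_neg_distrib]
  refine Finset.sum_congr rfl fun σ _ => ?_
  split_ifs
  · rw [← smul_neg]
    congr 1
    have := hpair (σ.symm i) (v ∘ σ)
    rw [← Function.update_comp_equiv] at this
    rw [Function.comp_apply, Equiv.apply_symm_apply] at this
    exact this
  · simp

end BracketInsert

theorem AlternatingMap.isAntisymmetric {K g L : Type*} [CommRing K] [AddCommGroup g] [Module K g]
    [AddCommGroup L] [Module K L] {n : ℕ} (F : AlternatingMap K g L (Fin n)) :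
    IsAntisymmetric ⇑F := by
  intro σ v
  rw [F.map_perm v σ]
  rfl

theorem AlternatingMap.isOddInEach {K g L : Type*} [CommRing K] [AddCommGroup g] [Module K g]
    [AddCommGroup L] [Module K L] {n : ℕ} (F : AlternatingMap K g L (Fin n)) :
    IsOddInEach ⇑F := by
  intro i v
  rw [F.map_update_neg, Function.update_eq_self]

section Torsionfree

variable {g L : Type*} [LieRing g] [LieRing L] [IsAddTorsionFree L] {n q₁ q₂ : ℕ}

theorem IsAntisymmetric.ceBracket {V : Type*} {F : (Fin q₁ → V) → L} {H : (Fin q₂ → V) → L}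
    (hF : IsAntisymmetric F) (hH : IsAntisymmetric H) : IsAntisymmetric (ceBracket F H) := by
  refine IsAntisymmetric.of_zsmul (c := ((q₁.factorial * q₂.factorial : ℕ) : ℤ)) ?_ ?_
  · exact_mod_cast (by positivity : q₁.factorial * q₂.factorial ≠ 0)
  · rw [← antisymmetrize_liePair hF hH]
    exact isAntisymmetric_antisymmetrize _

theorem IsAntisymmetric.ceDiff {F : (Fin n → g) → L} (hF : IsAntisymmetric F)
    (hF' : IsOddInEach F) : IsAntisymmetric (ceDiff F) := by
  refine IsAntisymmetric.of_zsmul (c := -(2 * n.factorial)) ?_ ?_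
  · have := n.factorial_ne_zero
    simpa
  · rw [← antisymmetrize_bracketDerivation hF hF']
    exact isAntisymmetric_antisymmetrize _

theorem antisymmetrize_liePair_bracketDerivation_left {F : (Fin q₁ → g) → L}
    {H : (Fin q₂ → g) → L} (hF : IsAntisymmetric F) (hF' : IsOddInEach F)
    (hH : IsAntisymmetric H) :
    antisymmetrize (liePair (bracketDerivation F) H) =
      (-(2 * (q₁.factorial * q₂.factorial)) : ℤ) • ceBracket (ceDiff F) H := by
  apply zsmul_right_injective
    (show (((q₁ + 1).factorial : ℕ) : ℤ) ≠ 0 by exact_mod_cast (q₁ + 1).factorial_ne_zero)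
  simp only
  rw [← antisymmetrize_liePair_antisymmetrize_left, antisymmetrize_bracketDerivation hF hF',
    liePair_zsmul_left, map_zsmul, antisymmetrize_liePair (hF.ceDiff hF') hH, smul_smul, smul_smul]
  congr 1
  push_cast
  ring

theorem antisymmetrize_liePair_bracketDerivation_right {F : (Fin q₁ → g) → L}
    {H : (Fin q₂ → g) → L} (hF : IsAntisymmetric F) (hH : IsAntisymmetric H)
    (hH' : IsOddInEach H) :
    antisymmetrize (liePair F (bracketDerivation H)) =
      (-(2 * (q₁.factorial * q₂.factorial)) : ℤ) • ceBracket F (ceDiff H) := by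
  apply zsmul_right_injective
    (show (((q₂ + 1).factorial : ℕ) : ℤ) ≠ 0 by exact_mod_cast (q₂ + 1).factorial_ne_zero)
  simp only
  rw [← antisymmetrize_liePair_antisymmetrize_right, antisymmetrize_bracketDerivation hH hH',
    liePair_zsmul_right, map_zsmul, antisymmetrize_liePair hF (hH.ceDiff hH'), smul_smul, smul_smul]
  congr 1
  push_cast
  ring

theorem castFn_zsmul {V W : Type*} [AddCommGroup W] {m : ℕ} (h : m = n) (c : ℤ)
    (F : (Fin m → V) → W) : castFn h (c • F) = c • castFn h F := rfl

/-- The graded Leibniz rule for maps of tuples that are antisymmetric and odd in each argument. -/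
theorem ceDiff_ceBracket (h₁ : q₁ + 1 + q₂ = q₁ + q₂ + 1)
    (h₂ : q₁ + (q₂ + 1) = q₁ + q₂ + 1) {F : (Fin q₁ → g) → L} {H : (Fin q₂ → g) → L}
    (hF : IsAntisymmetric F) (hF' : IsOddInEach F) (hH : IsAntisymmetric H)
    (hH' : IsOddInEach H) :
    ceDiff (ceBracket F H) =
      castFn h₁ (ceBracket (ceDiff F) H) +
        ((-1 : ℤ) ^ q₁) • castFn h₂ (ceBracket F (ceDiff H)) := by
  have hc : (-(2 * ((q₁ + q₂).factorial * (q₁.factorial * q₂.factorial))) : ℤ) ≠ 0 := by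
    have h0 := (q₁ + q₂).factorial_ne_zero
    have h1 := q₁.factorial_ne_zero
    have h2 := q₂.factorial_ne_zero
    simp [h0, h1, h2]
  apply zsmul_right_injective hc
  have h := antisymmetrize_bracketDerivation_antisymmetrize (liePair F H)
  rw [antisymmetrize_liePair hF hH, map_zsmul, map_zsmul,
    antisymmetrize_bracketDerivation (hF.ceBracket hH) (hF'.ceBracket hH'), smul_smul,
    bracketDerivation_liePair h₁ h₂, map_add, map_zsmul, antisymmetrize_castFn,
    antisymmetrize_castFn, antisymmetrize_liePair_bracketDerivation_left hF hF' hH,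
    antisymmetrize_liePair_bracketDerivation_right hF hH hH', castFn_zsmul, castFn_zsmul,
    smul_comm ((-1 : ℤ) ^ q₁), ← smul_add, smul_smul] at h
  simp only
  convert h using 2 <;> push_cast <;> ring

end Torsionfree

/-- the Chevalley–Eilenberg differential (for the trivial
`g`-module structure on a Lie algebra `L`) is a graded derivation of the
convolution bracket: `d₂[F,H] = [d₂F,H] + (−1)^{q₁}[F,d₂H]`; hence
`(⊕_q C^q, [·,·]_CE, d₂)` is a differential graded Lie algebra. -/
theorem ceDiff_graded_derivation_of_ceBracket
    {K g L : Type*} [Field K] [CharZero K] [LieRing g] [LieAlgebra K g]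
    [LieRing L] [LieAlgebra K L] {q₁ q₂ : ℕ}
    (F : AlternatingMap K g L (Fin q₁)) (H : AlternatingMap K g L (Fin q₂)) :
    ceDiff (ceBracket ⇑F ⇑H) =
      castFn (by omega) (ceBracket (ceDiff ⇑F) ⇑H) +
        ((-1 : ℤ) ^ q₁) • castFn (by omega) (ceBracket ⇑F (ceDiff ⇑H)) := by
  have : IsAddTorsionFree L := by
    refine ⟨fun n hn x y h => ?_⟩
    have hn' : (n : K) ≠ 0 := Nat.cast_ne_zero.2 hn
    apply smul_right_injective L hn'
    simpa only [Nat.cast_smul_eq_nsmul] using h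
  exact ceDiff_ceBracket _ _ F.isAntisymmetric F.isOddInEach H.isAntisymmetric H.isOddInEach
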